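/- arXiv:2108.03565 — 2 statements merged into one kernel-verified Lean document; each statement's English description precedes it below -/
import Mathlib

section
/- Let n ≥ 2. For any open compact subset 𝔫 of Fˣ, there exists a sufficiently large integer ℓ_𝔫 such that for all integers ℓ > m > ℓ_𝔫 and every g ∈ GL_n(F) satisfying det g ∈ 𝔫 and g ∈ M_n(𝔭^{-ℓ}) \ M_n(𝔭^{-m}), one has ∫_{K¹_{ℓ_𝔫}} ψ(tr(g·h)) d₁h = 0, where the integral is with respect to the Haar measure of SL_n(F) restricted to the open compact subgroup K¹_{ℓ_𝔫} = K_{ℓ_𝔫} ∩ SL_n(F). -/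
open MeasureTheory Matrix

/-- `M_n(𝔭^k)`: the set of `n × n` matrices over `F` all of whose entries lie in `𝔭^k`,
i.e. have norm at most `‖ϖ‖^k`, for `k : ℤ`. -/
def MnP (n : ℕ) {F : Type*} [NontriviallyNormedField F] (ϖ : F) (k : ℤ) :
    Set (Matrix (Fin n) (Fin n) F) :=
  {g | ∀ i j, ‖g i j‖ ≤ ‖ϖ‖ ^ k}

/-- The principal congruence subgroup `K_ℓ = I_n + M_n(𝔭^ℓ)`, as a set of matrices. -/
def Kcong (n : ℕ) {F : Type*} [NontriviallyNormedField F] (ϖ : F) (ℓ : ℤ) :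
    Set (Matrix (Fin n) (Fin n) F) :=
  {g | ∀ i j, ‖g i j - (1 : Matrix (Fin n) (Fin n) F) i j‖ ≤ ‖ϖ‖ ^ ℓ}

lemma det_one_add_smul_vecMulVec {R : Type*} [CommRing R] {n : ℕ} {u v : Fin n → R}
    (huv : v ⬝ᵥ u = 0) (t : R) :
    (1 + t • Matrix.vecMulVec u v).det = 1 := by
  rw [← Matrix.smul_vecMulVec, Matrix.vecMulVec_eq Unit,
    Matrix.det_one_add_replicateCol_mul_replicateRow, dotProduct_smul, huv, smul_zero, add_zero]

section Ultrametric

variable {F : Type*} [NontriviallyNormedField F] [IsUltrametricDist F]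
variable {n : ℕ}

lemma norm_sub_le_max_norm (x y : F) : ‖x - y‖ ≤ max ‖x‖ ‖y‖ := by
  rw [sub_eq_add_neg, ← norm_neg y]
  exact IsUltrametricDist.norm_add_le_max _ _

lemma norm_matrix_mul_entry_le {X Y : Matrix (Fin n) (Fin n) F} {a b : ℝ} (ha : 0 ≤ a)
    (hb : 0 ≤ b) (hX : ∀ i j, ‖X i j‖ ≤ a) (hY : ∀ i j, ‖Y i j‖ ≤ b) (i j : Fin n) :
    ‖(X * Y) i j‖ ≤ a * b := by
  rw [Matrix.mul_apply]
  refine IsUltrametricDist.norm_sum_le_of_forall_le_of_nonneg (by positivity) fun l _ => ?_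
  rw [norm_mul]
  exact mul_le_mul (hX i l) (hY l j) (norm_nonneg _) ha

lemma norm_trace_le {X : Matrix (Fin n) (Fin n) F} {a : ℝ} (ha : 0 ≤ a)
    (hX : ∀ i j, ‖X i j‖ ≤ a) : ‖X.trace‖ ≤ a :=
  IsUltrametricDist.norm_sum_le_of_forall_le_of_nonneg ha fun i _ => hX i i

lemma norm_prod_sub_prod_lt_one {ι : Type*} (s : Finset ι) (x y : ι → F)
    (hy : ∀ i, ‖y i‖ ≤ 1) (hxy : ∀ i, ‖x i - y i‖ < 1) :
    ‖∏ i ∈ s, x i - ∏ i ∈ s, y i‖ < 1 := by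
  classical
  have hx : ∀ i, ‖x i‖ ≤ 1 := fun i => by
    have h := IsUltrametricDist.norm_add_le_max (x i - y i) (y i)
    rw [sub_add_cancel] at h
    exact h.trans (max_le (hxy i).le (hy i))
  induction s using Finset.induction_on with
  | empty => simp
  | insert a s ha ih =>
    rw [Finset.prod_insert ha, Finset.prod_insert ha]
    have hys : ‖∏ i ∈ s, y i‖ ≤ 1 := by
      rw [norm_prod]
      exact Finset.prod_le_one (fun _ _ => norm_nonneg _) fun i _ => hy i
    have e : x a * ∏ i ∈ s, x i - y a * ∏ i ∈ s, y i =
        x a * (∏ i ∈ s, x i - ∏ i ∈ s, y i) + (x a - y a) * ∏ i ∈ s, y i := by ring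
    rw [e]
    refine (IsUltrametricDist.norm_add_le_max _ _).trans_lt (max_lt ?_ ?_)
    · rw [norm_mul]
      exact (mul_le_of_le_one_left (norm_nonneg _) (hx a)).trans_lt ih
    · rw [norm_mul]
      exact (mul_le_of_le_one_right (norm_nonneg _) hys).trans_lt (hxy a)

/-- A matrix congruent to the identity modulo the maximal ideal has determinant of norm one. -/
lemma norm_det_eq_one_of_near_one {M : Matrix (Fin n) (Fin n) F}
    (hM : ∀ i j, ‖M i j - (1 : Matrix (Fin n) (Fin n) F) i j‖ < 1) : ‖M.det‖ = 1 := by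
  have key : ‖M.det - (1 : Matrix (Fin n) (Fin n) F).det‖ < 1 := by
    rw [Matrix.det_apply, Matrix.det_apply, ← Finset.sum_sub_distrib]
    refine Finset.sum_induction _ (fun z : F => ‖z‖ < 1) (fun a b ha hb =>
      (IsUltrametricDist.norm_add_le_max _ _).trans_lt (max_lt ha hb)) (by simp) fun σ _ => ?_
    rw [← smul_sub]
    have := norm_prod_sub_prod_lt_one Finset.univ (fun i => M (σ i) i)
      (fun i => (1 : Matrix (Fin n) (Fin n) F) (σ i) i)
      (fun i => by rw [Matrix.one_apply]; split_ifs <;> simp) (fun i => hM _ _)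
    rcases Int.units_eq_one_or (Equiv.Perm.sign σ) with h | h
    · rw [h, one_smul]; exact this
    · rw [h, Units.neg_smul, one_smul, norm_neg]; exact this
  rw [Matrix.det_one] at key
  have h := IsUltrametricDist.norm_add_eq_max_of_norm_ne_norm
    (x := M.det - 1) (y := 1) (by rw [norm_one]; exact key.ne)
  rw [sub_add_cancel, norm_one, max_eq_right key.le] at h
  exact h

lemma norm_det_of_near_scalar {A : Matrix (Fin n) (Fin n) F} {a : F} (ha : a ≠ 0)
    (hA : ∀ i j, ‖A i j - a * (1 : Matrix (Fin n) (Fin n) F) i j‖ < ‖a‖) :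
    ‖A.det‖ = ‖a‖ ^ n := by
  have h1 : ‖(a⁻¹ • A).det‖ = 1 := by
    refine norm_det_eq_one_of_near_one fun i j => ?_
    have e : (a⁻¹ • A) i j - (1 : Matrix (Fin n) (Fin n) F) i j =
        a⁻¹ * (A i j - a * (1 : Matrix (Fin n) (Fin n) F) i j) := by
      rw [Matrix.smul_apply, smul_eq_mul]
      field_simp
    have ha' : 0 < ‖a‖ := norm_pos_iff.2 ha
    rw [e, norm_mul, norm_inv, inv_mul_lt_iff₀ ha', mul_one]
    exact hA i j
  rw [Matrix.det_smul, Fintype.card_fin, norm_mul, norm_pow, norm_inv, inv_pow] at h1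
  have : ‖a‖ ^ n ≠ 0 := pow_ne_zero _ (norm_ne_zero_iff.2 ha)
  field_simp at h1
  exact h1

/-- If `A` has an entry of norm `G > 0` and determinant of norm less than `G ^ n`, then some
integral square-zero matrix `N` of rank one pairs with `A` to an element of norm at least `G`. -/
lemma exists_nilpotent_trace_ge {A : Matrix (Fin n) (Fin n) F} {G : ℝ} (hG : 0 < G)
    (hmax : ∃ i j, ‖A i j‖ = G) (hdet : ‖A.det‖ < G ^ n) :
    ∃ N : Matrix (Fin n) (Fin n) F, (∀ i j, ‖N i j‖ ≤ 1) ∧ N * N = 0 ∧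
      (∀ t : F, (1 + t • N).det = 1) ∧ G ≤ ‖(N * A).trace‖ := by
  classical
  by_contra! hcon
  have huv : ∀ u v : Fin n → F, (∀ i, ‖u i‖ ≤ 1) → (∀ i, ‖v i‖ ≤ 1) → v ⬝ᵥ u = 0 →
      ‖(v ᵥ* A) ⬝ᵥ u‖ < G := by
    intro u v hu hv h0
    have h := hcon (Matrix.vecMulVec u v) (fun i j => by
      rw [Matrix.vecMulVec_apply, norm_mul]
      exact mul_le_one₀ (hu i) (norm_nonneg _) (hv j))
      (by rw [Matrix.vecMulVec_mul_vecMulVec, h0]; simp)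
      (det_one_add_smul_vecMulVec h0)
    rwa [Matrix.vecMulVec_mul, Matrix.trace_vecMulVec, dotProduct_comm] at h
  have hsingle : ∀ i l : Fin n, ‖(Pi.single i 1 : Fin n → F) l‖ ≤ 1 := by
    intro i l
    rw [Pi.single_apply]
    split_ifs <;> simp
  have hoff : ∀ i j, i ≠ j → ‖A i j‖ < G := by
    intro i j hij
    have h := huv (Pi.single j 1) (Pi.single i 1) (hsingle j) (hsingle i) (by simp [hij])
    simpa using h
  have hdiag : ∀ i j, ‖A i i - A j j‖ < G := by
    intro i j
    rcases eq_or_ne i j with rfl | hij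
    · simpa using hG
    have h := huv (Pi.single i 1 - Pi.single j 1) (Pi.single i 1 + Pi.single j 1)
      (fun l => (norm_sub_le_max_norm _ _).trans
        (max_le (hsingle i l) (hsingle j l)))
      (fun l => (IsUltrametricDist.norm_add_le_max _ _).trans
        (max_le (hsingle i l) (hsingle j l)))
      (by simp [hij, hij.symm])
    have e : A i i - A j j = ((Pi.single i 1 + Pi.single j 1) ᵥ* A) ⬝ᵥ
        (Pi.single i 1 - Pi.single j 1) + (A i j - A j i) := by
      simp [Matrix.add_vecMul, dotProduct_sub]
      ring
    rw [e]
    refine (IsUltrametricDist.norm_add_le_max _ _).trans_lt (max_lt h ?_)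
    exact (norm_sub_le_max_norm _ _).trans_lt
      (max_lt (hoff i j hij) (hoff j i hij.symm))
  obtain ⟨i, j, hij⟩ := hmax
  obtain rfl : i = j := by
    by_contra h
    exact (hoff i j h).ne hij
  refine hdet.ne ?_
  rw [← hij]
  refine norm_det_of_near_scalar (norm_pos_iff.1 (hij ▸ hG)) fun k l => ?_
  rw [hij]
  rcases eq_or_ne k l with rfl | hkl
  · simpa using hdiag k i
  · simpa [hkl] using hoff k l hkl

end Ultrametric

section Partition

variable {F : Type*} [NontriviallyNormedField F] {n : ℕ}

/-- The part of `E` lying in the closed entrywise ball of radius `ρ` around `h`. -/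
def entryBall (E : Set (Matrix (Fin n) (Fin n) F)) (ρ : ℝ) (h : Matrix (Fin n) (Fin n) F) :
    Set (Matrix (Fin n) (Fin n) F) :=
  {x | x ∈ E ∧ ∀ i j, ‖x i j - h i j‖ ≤ ρ}

lemma isClosed_setOf_entry_sub_le (h : Matrix (Fin n) (Fin n) F) (ρ : ℝ) :
    IsClosed {x : Matrix (Fin n) (Fin n) F | ∀ i j, ‖x i j - h i j‖ ≤ ρ} := by
  simp only [Set.ofPred_forall]
  refine isClosed_iInter fun i => isClosed_iInter fun j => ?_
  exact isClosed_le (by fun_prop) continuous_const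

lemma isClosed_entryBall {E : Set (Matrix (Fin n) (Fin n) F)} (hE : IsClosed E) (ρ : ℝ)
    (h : Matrix (Fin n) (Fin n) F) : IsClosed (entryBall E ρ h) :=
  hE.inter (isClosed_setOf_entry_sub_le h ρ)

lemma entryBall_subset_of_mem [IsUltrametricDist F] {E : Set (Matrix (Fin n) (Fin n) F)} {ρ : ℝ}
    {h h' y : Matrix (Fin n) (Fin n) F} (hy : y ∈ entryBall E ρ h) (hy' : y ∈ entryBall E ρ h') :
    entryBall E ρ h ⊆ entryBall E ρ h' := by
  refine fun x hx => ⟨hx.1, fun i j => ?_⟩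
  have e : x i j - h' i j = (x i j - h i j) - (y i j - h i j) + (y i j - h' i j) := by ring
  rw [e]
  exact (IsUltrametricDist.norm_add_le_max _ _).trans
    (max_le ((norm_sub_le_max_norm _ _).trans (max_le (hx.2 i j) (hy.2 i j))) (hy'.2 i j))

lemma setIntegral_eq_zero_of_entryBall [IsUltrametricDist F]
    [MeasurableSpace (Matrix (Fin n) (Fin n) F)]
    [BorelSpace (Matrix (Fin n) (Fin n) F)] {μ : Measure (Matrix (Fin n) (Fin n) F)}
    {E : Set (Matrix (Fin n) (Fin n) F)} (hEc : IsCompact E) (hEcl : IsClosed E)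
    {f : Matrix (Fin n) (Fin n) F → ℂ} (hf : IntegrableOn f E μ) {ρ : ℝ} (hρ : 0 < ρ)
    (hzero : ∀ h ∈ E, ∫ x in entryBall E ρ h, f x ∂μ = 0) : ∫ x in E, f x ∂μ = 0 := by
  classical
  obtain ⟨t, htE, htc⟩ := hEc.elim_nhds_subcover (fun h => {x | ∀ i j, ‖x i j - h i j‖ ≤ ρ})
    (fun h _ => by
      refine Filter.eventually_all.2 fun i => Filter.eventually_all.2 fun j => ?_
      have hc : Continuous fun x : Matrix (Fin n) (Fin n) F => ‖x i j - h i j‖ := by fun_prop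
      have := hc.tendsto h
      simp only [sub_self, norm_zero] at this
      exact this.eventually_le_const hρ)
  have hE : E = ⋃ B ∈ t.image (entryBall E ρ), B := by
    ext x
    simp only [Finset.mem_image, Set.mem_iUnion, exists_prop, exists_exists_and_eq_and]
    constructor
    · intro hx
      obtain ⟨h, hh, hxh⟩ := Set.mem_iUnion₂.1 (htc hx)
      exact ⟨h, hh, hx, hxh⟩
    · rintro ⟨h, -, hx⟩
      exact hx.1
  rw [hE, integral_biUnion_finset]
  · refine Finset.sum_eq_zero fun B hB => ?_
    obtain ⟨h, hh, rfl⟩ := Finset.mem_image.1 hB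
    exact hzero h (htE h hh)
  · intro B hB
    obtain ⟨h, hh, rfl⟩ := Finset.mem_image.1 hB
    exact (isClosed_entryBall hEcl ρ h).measurableSet
  · intro B hB B' hB' hne
    obtain ⟨h, hh, rfl⟩ := Finset.mem_image.1 hB
    obtain ⟨h', hh', rfl⟩ := Finset.mem_image.1 hB'
    refine Set.disjoint_left.2 fun y hy hy' => hne ?_
    exact (entryBall_subset_of_mem hy hy').antisymm (entryBall_subset_of_mem hy' hy)
  · intro B hB
    obtain ⟨h, hh, rfl⟩ := Finset.mem_image.1 hB
    exact hf.mono_set fun x hx => hx.1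

end Partition

lemma setIntegral_eq_zero_of_mul_left {F : Type*} [NontriviallyNormedField F] {n : ℕ}
    [MeasurableSpace (Matrix (Fin n) (Fin n) F)] [BorelSpace (Matrix (Fin n) (Fin n) F)]
    {μ : Measure (Matrix (Fin n) (Fin n) F)} {f : Matrix (Fin n) (Fin n) F → ℂ}
    (hf : Continuous f) {B : Set (Matrix (Fin n) (Fin n) F)} (hB : MeasurableSet B)
    {s : Matrix (Fin n) (Fin n) F} (hs : Measure.map (fun h => s * h) μ = μ)
    (hsB : ∀ x, s * x ∈ B ↔ x ∈ B) {c : ℂ} (hc : c ≠ 1)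
    (hfs : ∀ x ∈ B, f (s * x) = c * f x) : ∫ x in B, f x ∂μ = 0 := by
  have hcont : Continuous fun h : Matrix (Fin n) (Fin n) F => s * h := by fun_prop
  have h1 : ∫ x in B, f x ∂μ = c * ∫ x in B, f x ∂μ := by
    conv_lhs => rw [← hs]
    rw [setIntegral_map hB hf.aestronglyMeasurable hcont.aemeasurable]
    have : (fun h => s * h) ⁻¹' B = B := Set.ext hsB
    rw [this, setIntegral_congr_fun hB hfs, integral_const_mul]
  by_contra h0
  exact hc (mul_right_cancel₀ h0 (by rw [one_mul]; exact h1.symm))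

section Congruence

variable {F : Type*} [NontriviallyNormedField F] {n : ℕ}

lemma isClosed_Kcong_inter_det (ϖ : F) (L : ℤ) :
    IsClosed {h : Matrix (Fin n) (Fin n) F | h ∈ Kcong n ϖ L ∧ h.det = 1} :=
  (isClosed_setOf_entry_sub_le 1 _).inter (isClosed_eq (by fun_prop) continuous_const)

lemma isCompact_Kcong_inter_det [ProperSpace F] (ϖ : F) (L : ℤ) :
    IsCompact {h : Matrix (Fin n) (Fin n) F | h ∈ Kcong n ϖ L ∧ h.det = 1} := by
  have hc : IsCompact (Set.univ.pi fun i : Fin n => Set.univ.pi fun j : Fin n =>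
      Metric.closedBall ((1 : Matrix (Fin n) (Fin n) F) i j) (‖ϖ‖ ^ L)) :=
    isCompact_univ_pi fun i => isCompact_univ_pi fun j => isCompact_closedBall _ _
  refine IsCompact.of_isClosed_subset hc (isClosed_Kcong_inter_det ϖ L) ?_
  intro h hh i _ j _
  rw [mem_closedBall_iff_norm]
  exact hh.1 i j

lemma Kcong_norm_le_one [IsUltrametricDist F] {ϖ : F} {L : ℤ} (hL : ‖ϖ‖ ^ L ≤ 1)
    {h : Matrix (Fin n) (Fin n) F} (hh : h ∈ Kcong n ϖ L) (i j : Fin n) : ‖h i j‖ ≤ 1 := by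
  rw [← sub_add_cancel (h i j) ((1 : Matrix (Fin n) (Fin n) F) i j)]
  refine (IsUltrametricDist.norm_add_le_max _ _).trans (max_le ((hh i j).trans hL) ?_)
  rw [Matrix.one_apply]
  split_ifs <;> simp

/-- Left multiplication by `1 + t N`, with `N` integral and `t` small, preserves entrywise balls
in the congruence subgroup. -/
lemma one_add_smul_mul_mem_entryBall [IsUltrametricDist F] {ϖ : F} {L : ℤ} (hL : ‖ϖ‖ ^ L ≤ 1)
    {ρ : ℝ} (hρL : ρ ≤ ‖ϖ‖ ^ L) {N : Matrix (Fin n) (Fin n) F} (hN : ∀ i j, ‖N i j‖ ≤ 1)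
    {t : F} (ht : ‖t‖ ≤ ρ) (hdet : (1 + t • N).det = 1) {h x : Matrix (Fin n) (Fin n) F}
    (hx : x ∈ entryBall {h | h ∈ Kcong n ϖ L ∧ h.det = 1} ρ h) :
    (1 + t • N) * x ∈ entryBall {h | h ∈ Kcong n ϖ L ∧ h.det = 1} ρ h := by
  have hx1 := Kcong_norm_le_one hL hx.1.1
  have hρ : 0 ≤ ρ := (norm_nonneg t).trans ht
  have hNx : ∀ i j, ‖t * (N * x) i j‖ ≤ ρ := fun i j => by
    rw [norm_mul]
    have := norm_matrix_mul_entry_le zero_le_one zero_le_one hN hx1 i j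
    exact (mul_le_mul ht this (norm_nonneg _) hρ).trans (by simp)
  have e : ∀ i j, ((1 + t • N) * x) i j = t * (N * x) i j + x i j := fun i j => by
    rw [add_mul, one_mul, Matrix.smul_mul, Matrix.add_apply, Matrix.smul_apply, smul_eq_mul,
      add_comm]
  refine ⟨⟨fun i j => ?_, ?_⟩, fun i j => ?_⟩
  · rw [e, add_sub_assoc]
    exact (IsUltrametricDist.norm_add_le_max _ _).trans
      (max_le ((hNx i j).trans hρL) (hx.1.1 i j))
  · rw [Matrix.det_mul, hdet, hx.1.2, one_mul]
  · rw [e, add_sub_assoc]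
    exact (IsUltrametricDist.norm_add_le_max _ _).trans (max_le (hNx i j) (hx.2 i j))

end Congruence

/-- Let `F` be a non-Archimedean local field of characteristic zero with
uniformizer `ϖ`, and let `ψ` be an additive character of `F` trivial on `𝔬` but nontrivial on
`ϖ⁻¹𝔬`.  Let `n ≥ 2`.  For any open compact subset `𝔫` of `Fˣ` there is a sufficiently large
integer `ℓ_𝔫` such that for all integers `ℓ > m > ℓ_𝔫` and every `g ∈ GL_n(F)` with
`det g ∈ 𝔫` and `g ∈ M_n(𝔭^{-ℓ}) \ M_n(𝔭^{-m})`, the integral of `ψ(tr (g·h))` over the open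
compact subgroup `K¹_{ℓ_𝔫} = K_{ℓ_𝔫} ∩ SL_n(F)`, with respect to the Haar measure `μ₁` of
`SL_n(F)`, vanishes. -/
theorem statement0
    {F : Type*} [NontriviallyNormedField F] [CompleteSpace F] [ProperSpace F]
    [CharZero F]
    (hna : ∀ x y : F, ‖x + y‖ ≤ max ‖x‖ ‖y‖)
    (ϖ : F) (hϖ0 : 0 < ‖ϖ‖) (hϖ1 : ‖ϖ‖ < 1)
    (hdisc : ∀ x : F, x ≠ 0 → ∃ k : ℤ, ‖x‖ = ‖ϖ‖ ^ k)
    (ψ : F → ℂ) (hψc : Continuous ψ)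
    (hψadd : ∀ x y : F, ψ (x + y) = ψ x * ψ y)
    (hψtriv : ∀ x : F, ‖x‖ ≤ 1 → ψ x = 1)
    (hψnontriv : ∃ x : F, ‖x‖ ≤ ‖ϖ‖⁻¹ ∧ ψ x ≠ 1)
    (n : ℕ) (hn : 2 ≤ n)
    [MeasurableSpace (Matrix (Fin n) (Fin n) F)]
    [BorelSpace (Matrix (Fin n) (Fin n) F)]
    -- `μ₁` is a Haar measure of `SL_n(F)`, viewed as a measure on the matrix space that is
    -- supported on `SL_n(F)`, invariant under left translation by `SL_n(F)`, and finite on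
    -- compact sets
    (μ₁ : Measure (Matrix (Fin n) (Fin n) F))
    (hμ₁supp : μ₁ {h | h.det ≠ 1} = 0)
    (hμ₁inv : ∀ s : Matrix (Fin n) (Fin n) F, s.det = 1 →
      Measure.map (fun h => s * h) μ₁ = μ₁)
    (hμ₁fin : ∀ K : Set (Matrix (Fin n) (Fin n) F), IsCompact K → μ₁ K < ⊤)
    (𝔫 : Set F) (h𝔫o : IsOpen 𝔫) (h𝔫c : IsCompact 𝔫) (h𝔫0 : ∀ x ∈ 𝔫, x ≠ 0) :
    ∃ ℓ𝔫 : ℤ, 1 ≤ ℓ𝔫 ∧ ∀ ℓ m : ℤ, ℓ𝔫 < m → m < ℓ →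
      ∀ g : Matrix (Fin n) (Fin n) F, g.det ∈ 𝔫 →
        g ∈ MnP n ϖ (-ℓ) → g ∉ MnP n ϖ (-m) →
        ∫ h in {h : Matrix (Fin n) (Fin n) F | h ∈ Kcong n ϖ ℓ𝔫 ∧ h.det = 1},
          ψ ((g * h).trace) ∂μ₁ = 0 := by
  have : IsUltrametricDist F :=
    IsUltrametricDist.isUltrametricDist_of_forall_norm_add_le_max_norm hna
  have : IsFiniteMeasureOnCompacts μ₁ := ⟨fun K hK => hμ₁fin K hK⟩
  obtain ⟨C, hC⟩ := h𝔫c.isBounded.exists_norm_le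
  obtain ⟨L₀, hL₀⟩ := pow_unbounded_of_one_lt C (one_lt_inv₀ hϖ0 |>.2 hϖ1)
  have hmono : ∀ {a b : ℤ}, a ≤ b → ‖ϖ‖ ^ b ≤ ‖ϖ‖ ^ a := fun h =>
    zpow_le_zpow_right_of_le_one₀ hϖ0 hϖ1.le h
  refine ⟨L₀ + 1, by omega, fun ℓ m hm _ g hg _ hgm => ?_⟩
  set L : ℤ := L₀ + 1 with hLdef
  obtain ⟨i₁, j₁, hij⟩ : ∃ i j, ‖ϖ‖ ^ (-m) < ‖g i j‖ := by
    simpa [MnP] using hgm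
  have hLm : ‖ϖ‖ ^ (-L - 1) ≤ ‖ϖ‖ ^ (-m) := hmono (by omega)
  have : Nonempty (Fin n × Fin n) := ⟨(i₁, j₁)⟩
  obtain ⟨⟨i₀, j₀⟩, hmax⟩ := Finite.exists_max fun p : Fin n × Fin n => ‖g p.1 p.2‖
  set G : ℝ := ‖g i₀ j₀‖ with hGdef
  have hgG : ∀ i j, ‖g i j‖ ≤ G := fun i j => hmax (i, j)
  have hGL : ‖ϖ‖ ^ (-L - 1) < G := (hLm.trans_lt hij).trans_le (hgG _ _)
  have hG0 : 0 < G := (zpow_pos hϖ0 _).trans hGL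
  have hG1 : 1 ≤ G := by
    refine le_trans ?_ hGL.le
    simpa using hmono (show -L - 1 ≤ 0 by omega)
  have hdetG : ‖g.det‖ < G ^ n := by
    refine (hC _ hg).trans_lt (hL₀.trans_le ?_)
    refine le_trans ?_ (le_self_pow₀ hG1 (by omega))
    refine le_trans ?_ hGL.le
    rw [inv_pow, ← zpow_natCast, ← _root_.zpow_neg]
    exact hmono (by omega)
  have hQL : ‖ϖ‖ ^ L ≤ 1 := by simpa using hmono (show 0 ≤ L by omega)
  have hQL' : ‖ϖ‖ ^ L < 1 :=
    (by simpa using hmono (show 1 ≤ L by omega) : ‖ϖ‖ ^ L ≤ ‖ϖ‖).trans_lt hϖ1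
  set ρ : ℝ := ‖ϖ‖⁻¹ / G with hρdef
  have hρ0 : 0 < ρ := by positivity
  have hρL : ρ ≤ ‖ϖ‖ ^ L := by
    rw [hρdef, div_le_iff₀ hG0]
    refine le_trans (le_of_eq ?_) (mul_le_mul_of_nonneg_left hGL.le (zpow_pos hϖ0 _).le)
    rw [← zpow_add₀ hϖ0.ne', ← _root_.zpow_neg_one]
    congr 1
    ring
  have hρρ : ρ * (ρ * G) ≤ 1 := by
    have e : ρ * G = ‖ϖ‖⁻¹ := div_mul_cancel₀ _ hG0.ne'
    rw [e, ← div_eq_mul_inv, div_le_one hϖ0]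
    exact hρL.trans (by simpa using hmono (show 1 ≤ L by omega))
  have hfc : Continuous fun h : Matrix (Fin n) (Fin n) F => ψ ((g * h).trace) :=
    hψc.comp (by fun_prop)
  refine setIntegral_eq_zero_of_entryBall (isCompact_Kcong_inter_det ϖ L)
    (isClosed_Kcong_inter_det ϖ L)
    (hfc.continuousOn.integrableOn_compact (isCompact_Kcong_inter_det ϖ L)) hρ0 fun h hh => ?_
  have hhg : ∀ i j, ‖(h * g) i j - g i j‖ < G := fun i j => by
    have := norm_matrix_mul_entry_le (X := h - 1) (Y := g) (zpow_pos hϖ0 L).le hG0.le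
      (fun i j => hh.1 i j) hgG i j
    rw [sub_mul, one_mul, Matrix.sub_apply] at this
    exact this.trans_lt (mul_lt_of_lt_one_left hG0 hQL')
  obtain ⟨N, hN1, hNN, hNdet, hNtr⟩ := exists_nilpotent_trace_ge (A := h * g) hG0
    ⟨i₀, j₀, by
      have := IsUltrametricDist.norm_add_eq_max_of_norm_ne_norm (x := (h * g) i₀ j₀ - g i₀ j₀)
        (y := g i₀ j₀) (hhg i₀ j₀).ne
      rw [sub_add_cancel, max_eq_right (hhg i₀ j₀).le] at this
      exact this⟩
    (by rw [Matrix.det_mul, hh.2, one_mul]; exact hdetG)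
  obtain ⟨x₀, hx₀, hψx₀⟩ := hψnontriv
  set c : F := (N * (h * g)).trace with hcdef
  have hc0 : c ≠ 0 := norm_pos_iff.1 (hG0.trans_le hNtr)
  have ht : ‖x₀ / c‖ ≤ ρ := by
    rw [norm_div]
    exact div_le_div₀ (by positivity) hx₀ hG0 hNtr
  have hinv : ∀ t : F, (1 + (-t) • N) * (1 + t • N) = 1 := fun t => by
    simp [add_mul, mul_add, hNN]
  refine setIntegral_eq_zero_of_mul_left hfc
    (isClosed_entryBall (isClosed_Kcong_inter_det ϖ L) ρ h).measurableSet
    (hμ₁inv _ (hNdet (x₀ / c))) (fun x => ⟨fun hx => ?_, fun hx =>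
      one_add_smul_mul_mem_entryBall hQL hρL hN1 ht (hNdet _) hx⟩) hψx₀ fun x hx => ?_
  · have := one_add_smul_mul_mem_entryBall hQL hρL hN1 (t := -(x₀ / c)) (by rwa [norm_neg])
      (hNdet _) hx
    rwa [← mul_assoc, hinv, one_mul] at this
  · have htr : (g * ((1 + (x₀ / c) • N) * x)).trace =
        x₀ + (x₀ / c) * (N * ((x - h) * g)).trace + (g * x).trace := by
      have e : (g * ((1 + (x₀ / c) • N) * x)).trace =
          (g * x).trace + (x₀ / c) * (N * (x * g)).trace := by
        rw [add_mul, one_mul, mul_add, Matrix.trace_add, Matrix.smul_mul, Matrix.mul_smul,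
          Matrix.trace_smul, smul_eq_mul, Matrix.trace_mul_comm g (N * x), mul_assoc]
      rw [e, sub_mul, mul_sub, Matrix.trace_sub, ← hcdef]
      field_simp
      ring
    have hsmall : ‖(x₀ / c) * (N * ((x - h) * g)).trace‖ ≤ 1 := by
      have h1 := norm_trace_le (by positivity) (norm_matrix_mul_entry_le zero_le_one
        (by positivity) hN1 (norm_matrix_mul_entry_le (X := x - h) hρ0.le hG0.le
          (fun i j => hx.2 i j) hgG))
      rw [one_mul] at h1
      rw [norm_mul]
      exact (mul_le_mul ht h1 (norm_nonneg _) hρ0.le).trans hρρ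
    simp only [htr, hψadd, hψtriv _ hsmall, mul_one]
end

section
/- Let φ : GL_n(F) → ℂ be a locally constant function (for instance, any matrix coefficient of an irreducible admissible smooth representation of GL_n(F)). Then for every integer ℓ ≥ 1 and every x ∈ Fˣ, the integral ∫_{det g = x} (Φ_GJ * c_ℓ^∨)(g)·φ(g) d_xg over the fiber {g ∈ GL_n(F) : det g = x} converges absolutely. -/
open MeasureTheory Matrix

/-- The Haar measure `dg = d⁺g / |det g|^n` on `GL_n(F)`, obtained from the additive Haar
measure `μp` on `M_n(F)` by the density `|det g|_F^{-n}`. -/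
noncomputable def muGL (n : ℕ) {F : Type*} [NontriviallyNormedField F]
    [MeasurableSpace (Matrix (Fin n) (Fin n) F)]
    (μp : Measure (Matrix (Fin n) (Fin n) F)) : Measure (Matrix (Fin n) (Fin n) F) :=
  μp.withDensity fun g => ENNReal.ofReal ((‖g.det‖ ^ n)⁻¹)

/-- `c_ℓ = vol(K_ℓ)⁻¹ · 1_{K_ℓ}`, the characteristic function of the principal congruence
subgroup `K_ℓ` normalized by its volume for the Haar measure of `GL_n(F)`. -/
noncomputable def cFun (n : ℕ) {F : Type*} [NontriviallyNormedField F]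
    [MeasurableSpace (Matrix (Fin n) (Fin n) F)]
    (μp : Measure (Matrix (Fin n) (Fin n) F)) (ϖ : F) (ℓ : ℤ) :
    Matrix (Fin n) (Fin n) F → ℂ :=
  (Kcong n ϖ ℓ).indicator fun _ => (((muGL n μp (Kcong n ϖ ℓ)).toReal : ℂ))⁻¹

/-- The Godement–Jacquet kernel `Φ_GJ(g) = ψ(tr g)·|det g|_F^{n/2}`. -/
noncomputable def PhiGJ (n : ℕ) {F : Type*} [NontriviallyNormedField F] (ψ : F → ℂ) :
    Matrix (Fin n) (Fin n) F → ℂ :=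
  fun g => ψ g.trace * ((‖g.det‖ ^ ((n : ℝ) / 2) : ℝ) : ℂ)

/-- The convolution `(Φ_GJ * ξ^∨)(g) = ∫_{GL_n(F)} Φ_GJ(h)·ξ(g⁻¹h) dh`, the integral being
taken with respect to the Haar measure of `GL_n(F)`. -/
noncomputable def convGJ (n : ℕ) {F : Type*} [NontriviallyNormedField F]
    [MeasurableSpace (Matrix (Fin n) (Fin n) F)]
    (μp : Measure (Matrix (Fin n) (Fin n) F)) (ψ : F → ℂ)
    (ξ : Matrix (Fin n) (Fin n) F → ℂ) (g : Matrix (Fin n) (Fin n) F) : ℂ :=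
  ∫ h, PhiGJ n ψ h * ξ (g⁻¹ * h) ∂(muGL n μp)

/-- `t₁(x) = diag(x, 1, …, 1)`, a section of the determinant map. -/
noncomputable def t1 (n : ℕ) {F : Type*} [NontriviallyNormedField F] (x : F) :
    Matrix (Fin n) (Fin n) F :=
  Matrix.diagonal fun i => if (i : ℕ) = 0 then x else 1

theorem Matrix.norm_one_apply_le {F m : Type*} [NormedField F] [DecidableEq m] (i j : m) :
    ‖(1 : Matrix m m F) i j‖ ≤ 1 := by
  rw [one_apply]
  split_ifs <;> simp

theorem IsUltrametricDist.norm_sub_le_max_norm {E : Type*} [SeminormedAddCommGroup E]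
    [IsUltrametricDist E] (a b : E) : ‖a - b‖ ≤ max ‖a‖ ‖b‖ := by
  rw [sub_eq_add_neg, ← norm_neg b]
  exact norm_add_le_max _ _

section Ultrametric

variable {F : Type*} [NontriviallyNormedField F] [IsUltrametricDist F]

theorem norm_prod_sub_prod_le_of_forall_norm_sub_le {ι : Type*} (s : Finset ι) (a b : ι → F)
    {ε : ℝ} (hε : 0 ≤ ε) (ha : ∀ i, ‖a i‖ ≤ 1) (hb : ∀ i, ‖b i‖ ≤ 1)
    (hab : ∀ i, ‖a i - b i‖ ≤ ε) : ‖∏ i ∈ s, a i - ∏ i ∈ s, b i‖ ≤ ε := by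
  classical
  induction s using Finset.induction_on with
  | empty => simpa using hε
  | insert i s hi ih =>
    rw [Finset.prod_insert hi, Finset.prod_insert hi]
    have hsplit : a i * ∏ j ∈ s, a j - b i * ∏ j ∈ s, b j =
        a i * (∏ j ∈ s, a j - ∏ j ∈ s, b j) + (a i - b i) * ∏ j ∈ s, b j := by ring
    rw [hsplit]
    refine (IsUltrametricDist.norm_add_le_max _ _).trans (max_le ?_ ?_)
    · rw [norm_mul]
      exact (mul_le_of_le_one_left (norm_nonneg _) (ha i)).trans ih
    · rw [norm_mul]
      refine (mul_le_of_le_one_right (norm_nonneg _) ?_).trans (hab i)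
      rw [norm_prod]
      exact Finset.prod_le_one (fun _ _ => norm_nonneg _) fun j _ => hb j

namespace Matrix

variable {m : Type*} [Fintype m]

theorem norm_mul_apply_le_of_ultrametric {A B : Matrix m m F} {ε : ℝ} (hε : 0 ≤ ε)
    (hA : ∀ i j, ‖A i j‖ ≤ 1) (hB : ∀ i j, ‖B i j‖ ≤ ε) (i j : m) : ‖(A * B) i j‖ ≤ ε := by
  rw [mul_apply]
  refine IsUltrametricDist.norm_sum_le_of_forall_le_of_nonneg hε fun k _ => ?_
  rw [norm_mul]
  exact (mul_le_of_le_one_left (norm_nonneg _) (hA i k)).trans (hB k j)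

variable [DecidableEq m]

theorem norm_det_sub_det_le_of_ultrametric {A B : Matrix m m F} {ε : ℝ} (hε : 0 ≤ ε)
    (hA : ∀ i j, ‖A i j‖ ≤ 1) (hB : ∀ i j, ‖B i j‖ ≤ 1) (hAB : ∀ i j, ‖A i j - B i j‖ ≤ ε) :
    ‖A.det - B.det‖ ≤ ε := by
  rw [det_apply', det_apply', ← Finset.sum_sub_distrib]
  refine IsUltrametricDist.norm_sum_le_of_forall_le_of_nonneg hε fun σ _ => ?_
  rw [← mul_sub]
  have hsign : ‖((Equiv.Perm.sign σ : ℤ) : F)‖ = 1 := by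
    rcases Int.units_eq_one_or (Equiv.Perm.sign σ) with h | h <;> simp [h]
  rw [norm_mul, hsign, one_mul]
  exact norm_prod_sub_prod_le_of_forall_norm_sub_le _ _ _ hε (fun i => hA _ _)
    (fun i => hB _ _) fun i => hAB _ _

theorem norm_det_le_one_of_ultrametric {A : Matrix m m F} (hA : ∀ i j, ‖A i j‖ ≤ 1) :
    ‖A.det‖ ≤ 1 := by
  have h := norm_det_sub_det_le_of_ultrametric zero_le_one hA norm_one_apply_le fun i j =>
    (IsUltrametricDist.norm_sub_le_max_norm (A i j) ((1 : Matrix m m F) i j)).trans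
      (max_le (hA i j) (norm_one_apply_le i j))
  rw [det_one] at h
  calc ‖A.det‖ = ‖(A.det - 1) + 1‖ := by rw [sub_add_cancel]
    _ ≤ max ‖A.det - 1‖ ‖(1 : F)‖ := IsUltrametricDist.norm_add_le_max _ _
    _ ≤ 1 := max_le h (by simp)

theorem norm_inv_apply_le_of_ultrametric {A : Matrix m m F} (hA : ∀ i j, ‖A i j‖ ≤ 1)
    (hdet : ‖A.det‖ = 1) (i j : m) : ‖A⁻¹ i j‖ ≤ 1 := by
  rw [inv_def, smul_apply, smul_eq_mul, norm_mul, Ring.inverse_eq_inv', norm_inv, hdet, inv_one,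
    one_mul, adjugate_apply]
  refine norm_det_le_one_of_ultrametric fun k l => ?_
  rw [updateRow_apply]
  split_ifs
  · rw [Pi.single_apply]
    split_ifs <;> simp
  · exact hA k l

end Matrix

variable {n : ℕ} {ϖ : F} {ℓ : ℤ}

theorem norm_apply_le_one_of_mem_Kcong (hr : ‖ϖ‖ ^ ℓ < 1) {k : Matrix (Fin n) (Fin n) F}
    (hk : k ∈ Kcong n ϖ ℓ) (i j : Fin n) : ‖k i j‖ ≤ 1 := by
  calc ‖k i j‖ = ‖(k i j - (1 : Matrix (Fin n) (Fin n) F) i j) +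
        (1 : Matrix (Fin n) (Fin n) F) i j‖ := by rw [sub_add_cancel]
    _ ≤ max _ _ := IsUltrametricDist.norm_add_le_max _ _
    _ ≤ 1 := max_le ((hk i j).trans hr.le) (norm_one_apply_le i j)

theorem norm_det_eq_one_of_mem_Kcong (hr : ‖ϖ‖ ^ ℓ < 1) {k : Matrix (Fin n) (Fin n) F}
    (hk : k ∈ Kcong n ϖ ℓ) : ‖k.det‖ = 1 := by
  have h := norm_det_sub_det_le_of_ultrametric (zpow_nonneg (norm_nonneg ϖ) ℓ)
    (norm_apply_le_one_of_mem_Kcong hr hk) norm_one_apply_le hk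
  rw [det_one] at h
  have h1 : ‖k.det - 1‖ < ‖(1 : F)‖ := by rw [norm_one]; exact h.trans_lt hr
  have h2 := IsUltrametricDist.norm_add_eq_max_of_norm_ne_norm h1.ne
  rwa [sub_add_cancel, max_eq_right h1.le, norm_one] at h2

theorem inv_mul_mem_Kcong_iff (hr : ‖ϖ‖ ^ ℓ < 1) {k : Matrix (Fin n) (Fin n) F}
    (hk : k ∈ Kcong n ϖ ℓ) (m : Matrix (Fin n) (Fin n) F) :
    k⁻¹ * m ∈ Kcong n ϖ ℓ ↔ m ∈ Kcong n ϖ ℓ := by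
  have hε : 0 ≤ ‖ϖ‖ ^ ℓ := zpow_nonneg (norm_nonneg ϖ) ℓ
  have hk1 := norm_apply_le_one_of_mem_Kcong hr hk
  have hdet := norm_det_eq_one_of_mem_Kcong hr hk
  have hu : IsUnit k.det := by
    rw [isUnit_iff_ne_zero, ← norm_ne_zero_iff, hdet]
    exact one_ne_zero
  constructor
  · intro h i j
    have h1 : m - 1 = k * (k⁻¹ * m - 1) + (k - 1) := by
      rw [mul_sub, mul_nonsing_inv_cancel_left _ _ hu]; simp
    rw [← Matrix.sub_apply, h1, Matrix.add_apply]
    exact (IsUltrametricDist.norm_add_le_max _ _).trans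
      (max_le (norm_mul_apply_le_of_ultrametric hε hk1 h i j) (hk i j))
  · intro h i j
    have h1 : k⁻¹ * m - 1 = k⁻¹ * ((m - 1) - (k - 1)) := by
      rw [sub_sub_sub_cancel_right, mul_sub, nonsing_inv_mul _ hu]
    rw [← Matrix.sub_apply, h1]
    refine norm_mul_apply_le_of_ultrametric hε (norm_inv_apply_le_of_ultrametric hk1 hdet)
      (fun i j => ?_) i j
    exact (IsUltrametricDist.norm_sub_le_max_norm _ _).trans (max_le (h i j) (hk i j))

theorem add_mem_Kcong {k Y : Matrix (Fin n) (Fin n) F} (hk : k ∈ Kcong n ϖ ℓ)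
    (hY : Y ∈ MnP n ϖ ℓ) : k + Y ∈ Kcong n ϖ ℓ := fun i j => by
  rw [Matrix.add_apply, add_sub_right_comm]
  exact (IsUltrametricDist.norm_add_le_max _ _).trans (max_le (hk i j) (hY i j))

theorem add_mem_Kcong_iff {k Y : Matrix (Fin n) (Fin n) F} (hY : Y ∈ MnP n ϖ ℓ) :
    k + Y ∈ Kcong n ϖ ℓ ↔ k ∈ Kcong n ϖ ℓ := by
  refine ⟨fun h => ?_, fun h => add_mem_Kcong h hY⟩
  have hY' : -Y ∈ MnP n ϖ ℓ := fun i j => by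
    rw [Matrix.neg_apply, norm_neg]
    exact hY i j
  simpa using add_mem_Kcong h hY'

section Convolution

variable [MeasurableSpace (Matrix (Fin n) (Fin n) F)] (μp : Measure (Matrix (Fin n) (Fin n) F))
  (ψ : F → ℂ)

theorem eventually_convGJ_cFun_eq (hϖ : 0 < ‖ϖ‖) (hr : ‖ϖ‖ ^ ℓ < 1)
    {g₀ : Matrix (Fin n) (Fin n) F} (hg₀ : IsUnit g₀.det) :
    ∀ᶠ g in nhds g₀, convGJ n μp ψ (cFun n μp ϖ ℓ) g = convGJ n μp ψ (cFun n μp ϖ ℓ) g₀ := by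
  have hK : ∀ᶠ g in nhds g₀, g₀⁻¹ * g ∈ Kcong n ϖ ℓ := by
    refine Filter.eventually_all.2 fun i => Filter.eventually_all.2 fun j => ?_
    have hc : Continuous fun g : Matrix (Fin n) (Fin n) F =>
        ‖(g₀⁻¹ * g) i j - (1 : Matrix (Fin n) (Fin n) F) i j‖ :=
      (((continuous_const.matrix_mul continuous_id).matrix_elem i j).sub continuous_const).norm
    refine (hc.continuousAt.eventually_lt continuousAt_const ?_).mono fun g hg => le_of_lt hg
    simpa [nonsing_inv_mul _ hg₀] using zpow_pos hϖ ℓ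
  filter_upwards [hK] with g hg
  have hinv : g⁻¹ = (g₀⁻¹ * g)⁻¹ * g₀⁻¹ := by
    rw [← Matrix.mul_inv_rev, mul_nonsing_inv_cancel_left _ _ hg₀]
  unfold convGJ
  congr 1
  ext h
  congr 1
  rw [hinv, mul_assoc]
  have hiff := inv_mul_mem_Kcong_iff hr hg (g₀⁻¹ * h)
  by_cases hh : g₀⁻¹ * h ∈ Kcong n ϖ ℓ
  · rw [cFun, Set.indicator_of_mem hh, Set.indicator_of_mem (hiff.2 hh)]
  · rw [cFun, Set.indicator_of_notMem hh, Set.indicator_of_notMem (mt hiff.1 hh)]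

variable [BorelSpace (Matrix (Fin n) (Fin n) F)]

theorem convGJ_cFun_eq_zero_of_translate [ProperSpace F] [μp.IsAddHaarMeasure]
    (hψadd : ∀ x y : F, ψ (x + y) = ψ x * ψ y) (hr : ‖ϖ‖ ^ ℓ < 1)
    {g Y : Matrix (Fin n) (Fin n) F} (hg : IsUnit g.det) (hY : Y ∈ MnP n ϖ ℓ)
    (hψ : ψ (g * Y).trace ≠ 1) : convGJ n μp ψ (cFun n μp ϖ ℓ) g = 0 := by
  have hdens : Measurable fun h : Matrix (Fin n) (Fin n) F =>
      ENNReal.ofReal ((‖h.det‖ ^ n)⁻¹) := by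
    have : Measurable fun h : Matrix (Fin n) (Fin n) F => ‖h.det‖ :=
      (continuous_id.matrix_det.norm).measurable
    fun_prop
  unfold convGJ muGL
  rw [integral_withDensity_eq_integral_toReal_smul hdens
    (Filter.Eventually.of_forall fun _ => ENNReal.ofReal_lt_top)]
  set I : Matrix (Fin n) (Fin n) F → ℂ := fun h => (ENNReal.ofReal ((‖h.det‖ ^ n)⁻¹)).toReal •
    (PhiGJ n ψ h * cFun n μp ϖ ℓ (g⁻¹ * h)) with hI
  have hnorm : ∀ h, g⁻¹ * h ∈ Kcong n ϖ ℓ → ‖h.det‖ = ‖g.det‖ := fun h hh => by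
    rw [← mul_nonsing_inv_cancel_left g h hg, det_mul, norm_mul,
      norm_det_eq_one_of_mem_Kcong hr hh, mul_one]
  have htrans : ∀ h, I (h + g * Y) = ψ (g * Y).trace * I h := fun h => by
    have hmul : g⁻¹ * (h + g * Y) = g⁻¹ * h + Y := by
      rw [mul_add, nonsing_inv_mul_cancel_left _ _ hg]
    have hiff := add_mem_Kcong_iff (k := g⁻¹ * h) hY
    by_cases hh : g⁻¹ * h ∈ Kcong n ϖ ℓ
    · have h1 := hnorm _ hh
      have h2 := hnorm (h + g * Y) (by rw [hmul]; exact hiff.2 hh)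
      simp only [hI, PhiGJ, cFun, hmul, h1, h2, Set.indicator_of_mem hh,
        Set.indicator_of_mem (hiff.2 hh), trace_add, hψadd, Complex.real_smul]
      ring
    · simp only [hI, cFun, hmul, Set.indicator_of_notMem hh,
        Set.indicator_of_notMem (mt hiff.1 hh), mul_zero, smul_zero]
  have hint : ∫ h, I h ∂μp = ψ (g * Y).trace * ∫ h, I h ∂μp := by
    rw [← integral_const_mul, ← integral_add_right_eq_self I (g * Y)]
    simp only [htrans]
  by_contra hne
  exact hψ (mul_right_cancel₀ hne (by rw [one_mul]; exact hint.symm))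

theorem mem_MnP_of_convGJ_cFun_ne_zero [ProperSpace F] [μp.IsAddHaarMeasure]
    (hϖ0 : 0 < ‖ϖ‖) (hϖ1 : ‖ϖ‖ < 1) (hdisc : ∀ x : F, x ≠ 0 → ∃ k : ℤ, ‖x‖ = ‖ϖ‖ ^ k)
    (hψadd : ∀ x y : F, ψ (x + y) = ψ x * ψ y)
    (hψnontriv : ∃ x : F, ‖x‖ ≤ ‖ϖ‖⁻¹ ∧ ψ x ≠ 1) (hr : ‖ϖ‖ ^ ℓ < 1)
    {g : Matrix (Fin n) (Fin n) F} (hg : IsUnit g.det)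
    (hne : convGJ n μp ψ (cFun n μp ϖ ℓ) g ≠ 0) : g ∈ MnP n ϖ (-ℓ) := by
  intro i j
  by_contra! hlt
  refine hne ?_
  obtain ⟨y, hy, hψy⟩ := hψnontriv
  have hgij : g i j ≠ 0 := norm_pos_iff.1 ((zpow_pos hϖ0 _).trans hlt)
  obtain ⟨k, hk⟩ := hdisc _ hgij
  have hkl : k ≤ -ℓ - 1 := by
    rw [hk, zpow_lt_zpow_iff_right_of_lt_one₀ hϖ0 hϖ1] at hlt
    omega
  refine convGJ_cFun_eq_zero_of_translate μp ψ hψadd hr hg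
    (Y := Matrix.single j i (y / g i j)) (fun a b => ?_) ?_
  · rw [Matrix.single_apply]
    split_ifs
    · rw [norm_div, hk, div_le_iff₀ (zpow_pos hϖ0 _), ← zpow_add₀ hϖ0.ne']
      refine hy.trans ?_
      rw [← _root_.zpow_neg_one]
      exact zpow_le_zpow_right_of_le_one₀ hϖ0 hϖ1.le (by omega)
    · rw [norm_zero]
      exact (zpow_pos hϖ0 _).le
  · rwa [trace_mul_single, op_smul_eq_mul, mul_div_cancel₀ _ hgij]

end Convolution

end Ultrametric

theorem isCompact_MnP {n : ℕ} {F : Type*} [NontriviallyNormedField F] [ProperSpace F] (ϖ : F)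
    (k : ℤ) : IsCompact (MnP n ϖ k) := by
  have heq : MnP n ϖ k = Set.univ.pi fun _ : Fin n => Set.univ.pi fun _ : Fin n =>
      Metric.closedBall (0 : F) (‖ϖ‖ ^ k) := by
    refine Set.ext fun g => ⟨fun h i _ j _ => ?_, fun h i j => ?_⟩
    · exact mem_closedBall_zero_iff.2 (h i j)
    · exact mem_closedBall_zero_iff.1 (h i trivial j trivial)
  rw [heq]
  exact isCompact_univ_pi fun _ => isCompact_univ_pi fun _ => isCompact_closedBall _ _

theorem t1_det_isUnit (n : ℕ) {F : Type*} [NontriviallyNormedField F] {x : F} (hx : x ≠ 0) :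
    IsUnit (t1 n x).det := by
  rw [t1, det_diagonal, isUnit_iff_ne_zero, Finset.prod_ne_zero_iff]
  intro i _
  split_ifs
  exacts [hx, one_ne_zero]

/-- Let `φ : GL_n(F) → ℂ` be a locally constant function.  Then for every
integer `ℓ ≥ 1` and every `x ∈ Fˣ`, the integral `∫_{det g = x} (Φ_GJ * c_ℓ^∨)(g)·φ(g) d_xg`
over the fiber `{g ∈ GL_n(F) : det g = x}` converges absolutely.  The fiber carries the
`SL_n(F)`-invariant measure `d_xg`, the pushforward of the Haar measure `μ₁` of `SL_n(F)`
under `h ↦ t₁(x)·h`; accordingly the fiber integral is `∫_{SL_n(F)} f(t₁(x)h) dμ₁(h)` and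
absolute convergence is integrability with respect to `μ₁`. -/
theorem statement4
    {F : Type*} [NontriviallyNormedField F] [CompleteSpace F] [ProperSpace F]
    [CharZero F] [MeasurableSpace F] [BorelSpace F]
    (hna : ∀ x y : F, ‖x + y‖ ≤ max ‖x‖ ‖y‖)
    (ϖ : F) (hϖ0 : 0 < ‖ϖ‖) (hϖ1 : ‖ϖ‖ < 1)
    (hdisc : ∀ x : F, x ≠ 0 → ∃ k : ℤ, ‖x‖ = ‖ϖ‖ ^ k)
    (ψ : F → ℂ) (hψc : Continuous ψ)
    (hψadd : ∀ x y : F, ψ (x + y) = ψ x * ψ y)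
    (hψtriv : ∀ x : F, ‖x‖ ≤ 1 → ψ x = 1)
    (hψnontriv : ∃ x : F, ‖x‖ ≤ ‖ϖ‖⁻¹ ∧ ψ x ≠ 1)
    (n : ℕ)
    [MeasurableSpace (Matrix (Fin n) (Fin n) F)]
    [BorelSpace (Matrix (Fin n) (Fin n) F)]
    -- `μp` is the additive Haar measure `d⁺X` on `M_n(F)`
    (μp : Measure (Matrix (Fin n) (Fin n) F)) [μp.IsAddHaarMeasure]
    -- `μ₁` is a Haar measure of `SL_n(F)`, viewed as a measure on the matrix space
    (μ₁ : Measure (Matrix (Fin n) (Fin n) F))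
    (hμ₁supp : μ₁ {h | h.det ≠ 1} = 0)
    (hμ₁inv : ∀ s : Matrix (Fin n) (Fin n) F, s.det = 1 →
      Measure.map (fun h => s * h) μ₁ = μ₁)
    (hμ₁fin : ∀ K : Set (Matrix (Fin n) (Fin n) F), IsCompact K → μ₁ K < ⊤)
    -- `φ` is locally constant on `GL_n(F)`
    (φ : Matrix (Fin n) (Fin n) F → ℂ)
    (hφ : ∀ g : Matrix (Fin n) (Fin n) F, IsUnit g.det →
      ∀ᶠ g' in nhds g, φ g' = φ g)
    (ℓ : ℤ) (hℓ : 1 ≤ ℓ) (x : F) (hx : x ≠ 0) :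
    Integrable
      (fun h => convGJ n μp ψ (cFun n μp ϖ ℓ) (t1 n x * h) * φ (t1 n x * h)) μ₁ := by
  have : IsUltrametricDist F :=
    IsUltrametricDist.isUltrametricDist_of_forall_norm_add_le_max_norm hna
  have hr : ‖ϖ‖ ^ ℓ < 1 := zpow_lt_one₀ hϖ0 hϖ1 (by omega)
  have ht := t1_det_isUnit n hx
  set t := t1 n x
  set f := fun h => convGJ n μp ψ (cFun n μp ϖ ℓ) (t * h) * φ (t * h)
  have hcont : Continuous fun h : Matrix (Fin n) (Fin n) F => t * h :=
    continuous_const.matrix_mul continuous_id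
  have hunit : ∀ h : Matrix (Fin n) (Fin n) F, h.det = 1 → IsUnit (t * h).det := fun h hh => by
    rwa [det_mul, hh, mul_one]
  let C : Set (Matrix (Fin n) (Fin n) F) :=
    {h | h.det = 1} ∩ (fun h => t * h) ⁻¹' MnP n ϖ (-ℓ)
  have hCclosed : IsClosed C :=
    (isClosed_eq continuous_id.matrix_det continuous_const).inter
      ((isCompact_MnP ϖ (-ℓ)).isClosed.preimage hcont)
  have hC : IsCompact C := by
    refine ((isCompact_MnP ϖ (-ℓ)).image
      (f := fun h : Matrix (Fin n) (Fin n) F => t⁻¹ * h)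
      (continuous_const.matrix_mul continuous_id)).of_isClosed_subset hCclosed fun h hh => ?_
    exact ⟨t * h, hh.2, nonsing_inv_mul_cancel_left _ _ ht⟩
  have hfcont : ContinuousOn f C := fun h hh => by
    have hu := hunit h hh.1
    have hev := hcont.continuousAt.eventually
      ((eventually_convGJ_cFun_eq μp ψ hϖ0 hr hu).and (hφ _ hu))
    refine (continuousAt_const.congr (f := fun _ => f h) ?_).continuousWithinAt
    filter_upwards [hev] with h' hh'
    simp only [f, hh'.1, hh'.2]
  have : IsFiniteMeasureOnCompacts μ₁ := ⟨fun K hK => hμ₁fin K hK⟩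
  have hint : IntegrableOn f C μ₁ := hfcont.integrableOn_compact hC
  refine (hint.integrable_indicator hCclosed.measurableSet).congr ?_
  have hae : ∀ᵐ h ∂μ₁, h.det = 1 := hμ₁supp
  filter_upwards [hae] with h hh
  by_cases hhC : h ∈ C
  · rw [Set.indicator_of_mem hhC]
  · rw [Set.indicator_of_notMem hhC]
    by_contra hne
    refine hhC ⟨hh, mem_MnP_of_convGJ_cFun_ne_zero μp ψ hϖ0 hϖ1 hdisc hψadd hψnontriv hr
      (hunit h hh) fun h0 => hne ?_⟩
    simp only [f, h0, zero_mul]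
end
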